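/- Let n ≥ 2 be an integer, X an n-Urysohn topological space that is locally n-H-closed (every point has an open neighborhood U such that the subspace cl(U) satisfies the n-H-closed covering property), and κ, λ infinite cardinals. If wL(X) ≤ λ and χ(X) ≤ κ, then |X| ≤ λ^κ. -/

import Mathlib

open Set Cardinal

universe u

/-- `X` is `n`-Urysohn. -/
def NUrysohn (X : Type*) [TopologicalSpace X] (n : ℕ) : Prop :=
  ∀ x : Fin n → X, Function.Injective x →
    ∃ U : Fin n → Set X, (∀ i, IsOpen (U i) ∧ x i ∈ U i) ∧
      (⋂ i, closure (U i)) = ∅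

/-- The `n`-H-closed covering property for a space `Z`. -/
def NHClosedCovering (Z : Type*) [TopologicalSpace Z] (n : ℕ) : Prop :=
  ∀ A : Set Z, #A ≤ ((n - 2 : ℕ) : Cardinal) →
    ∀ 𝒰 : Set (Set Z), (∀ U ∈ 𝒰, IsOpen U) → Set.univ \ A ⊆ ⋃₀ 𝒰 →
      ∃ 𝒱 ⊆ 𝒰, 𝒱.Finite ∧ (⋃ V ∈ 𝒱, closure V) = Set.univ

/-- `X` is locally `n`-H-closed: every point has an open neighbourhood whose
closure, as a subspace, is `n`-H-closed. -/
def LocallyNHClosed (X : Type*) [TopologicalSpace X] (n : ℕ) : Prop :=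
  ∀ x : X, ∃ U : Set X, IsOpen U ∧ x ∈ U ∧ NHClosedCovering (↥(closure U)) n

/-- The weak Lindelöf degree of `X` is at most `κ`: every open cover has a
subfamily of cardinality `≤ κ` whose union is dense. -/
def WeakLindelofLe (X : Type*) [TopologicalSpace X] (κ : Cardinal) : Prop :=
  ∀ 𝒰 : Set (Set X), (∀ U ∈ 𝒰, IsOpen U) → ⋃₀ 𝒰 = Set.univ →
    ∃ 𝒱 ⊆ 𝒰, #𝒱 ≤ κ ∧ closure (⋃₀ 𝒱) = Set.univ

/-- The character of `X` is at most `κ`. -/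
def CharLe (X : Type*) [TopologicalSpace X] (κ : Cardinal) : Prop :=
  ∀ x : X, ∃ ℬ : Set (Set X), #ℬ ≤ κ ∧ (∀ B ∈ ℬ, B ∈ nhds x) ∧
    ∀ U ∈ nhds x, ∃ B ∈ ℬ, B ⊆ U

/-- A system of neighbourhood bases at all points of `X`, indexed by a single type `K`. -/
structure IsNhdsSystem {X K : Type u} [TopologicalSpace X] (b : X → K → Set X) : Prop where
  mem : ∀ x k, b x k ∈ nhds x
  base : ∀ x, ∀ U ∈ nhds x, ∃ k, b x k ⊆ U

theorem CharLe.exists_isNhdsSystem {X K : Type u} [TopologicalSpace X]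
    (h : CharLe X #K) : ∃ b : X → K → Set X, IsNhdsSystem b := by
  have key : ∀ x : X, ∃ f : K → Set X, (∀ k, f k ∈ nhds x) ∧
      ∀ U ∈ nhds x, ∃ k, f k ⊆ U := by
    intro x
    obtain ⟨ℬ, hc, hm, hb⟩ := h x
    obtain ⟨B₀, hB₀, -⟩ := hb univ Filter.univ_mem
    have : Nonempty ℬ := ⟨⟨B₀, hB₀⟩⟩
    obtain ⟨e⟩ := Cardinal.le_def _ _ |>.1 hc
    have hs := Function.invFun_surjective e.injective
    refine ⟨fun k => (Function.invFun e k).1, fun k => hm _ (Function.invFun e k).2, ?_⟩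
    intro U hU
    obtain ⟨B, hB, hBU⟩ := hb U hU
    obtain ⟨k, hk⟩ := hs ⟨B, hB⟩
    exact ⟨k, by simpa [hk] using hBU⟩
  choose b hb using key
  exact ⟨b, fun x => (hb x).1, fun x => (hb x).2⟩

theorem CharLe.subtype {X : Type u} [TopologicalSpace X] {κ : Cardinal.{u}}
    (h : CharLe X κ) (S : Set X) : CharLe S κ := by
  intro x
  obtain ⟨ℬ, hc, hm, hb⟩ := h x
  refine ⟨(fun B => Subtype.val ⁻¹' B) '' ℬ, Cardinal.mk_image_le.trans hc, ?_, ?_⟩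
  · rintro _ ⟨B, hB, rfl⟩
    exact continuous_subtype_val.continuousAt.preimage_mem_nhds (hm B hB)
  · intro U hU
    rw [nhds_subtype_eq_comap, Filter.mem_comap] at hU
    obtain ⟨V, hV, hVU⟩ := hU
    obtain ⟨B, hB, hBV⟩ := hb V hV
    exact ⟨_, ⟨B, hB, rfl⟩, (preimage_mono hBV).trans hVU⟩

theorem NUrysohn.subtype {X : Type u} [TopologicalSpace X] {n : ℕ}
    (h : NUrysohn X n) (S : Set X) : NUrysohn S n := by
  intro x hx
  obtain ⟨U, hU, he⟩ := h (fun i => (x i : X)) (Subtype.val_injective.comp hx)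
  refine ⟨fun i => Subtype.val ⁻¹' U i,
    fun i => ⟨(hU i).1.preimage continuous_subtype_val, (hU i).2⟩, ?_⟩
  rw [eq_empty_iff_forall_notMem]
  intro z hz
  have : (z : X) ∈ ⋂ i, closure (U i) := mem_iInter.2 fun i =>
    continuous_subtype_val.closure_preimage_subset _ (mem_iInter.1 hz i)
  simp [he] at this

/-- The points all of whose basic closed neighbourhoods are witnessed by the function `f`. -/
def witnessedBy {X K : Type u} [TopologicalSpace X] (b : X → K → Set X) (f : Finset K → X) :
    Set X :=
  {x | ∀ F : Finset K, f F ∈ closure (⋂ k ∈ F, b x k)}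

theorem NUrysohn.exists_enumeration {X K : Type u} [TopologicalSpace X] {n : ℕ}
    (h : NUrysohn X n) {b : X → K → Set X} (hb : IsNhdsSystem b) (f : Finset K → X) :
    ∃ p : Fin n → X, witnessedBy b f ⊆ range p := by
  classical
  have hlt : ¬ (n : Cardinal) ≤ #(witnessedBy b f) := by
    intro hle
    have hle' : Cardinal.lift.{u} #(Fin n) ≤ Cardinal.lift.{0} #(witnessedBy b f) := by
      simpa using hle
    obtain ⟨e⟩ := Cardinal.lift_mk_le'.1 hle'
    obtain ⟨U, hU, he⟩ := h (fun i => (e i : X)) (Subtype.val_injective.comp e.injective)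
    choose k hk using fun i => hb.base _ (U i) ((hU i).1.mem_nhds (hU i).2)
    have : f (Finset.univ.image k) ∈ ⋂ i, closure (U i) := by
      refine mem_iInter.2 fun i => closure_mono ?_ ((e i).2 (Finset.univ.image k))
      exact (biInter_subset_of_mem (by simp)).trans (hk i)
    simp [he] at this
  rcases (witnessedBy b f).eq_empty_or_nonempty with h0 | h0
  · exact ⟨fun _ => f ∅, by simp [h0]⟩
  · have := h0.to_subtype
    have hle : Cardinal.lift.{0} #(witnessedBy b f) ≤ Cardinal.lift.{u} #(Fin n) := by
      simpa using (not_le.1 hlt).le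
    obtain ⟨e⟩ := Cardinal.lift_mk_le'.1 hle
    refine ⟨fun i => (Function.invFun e i).1, fun x hx => ?_⟩
    obtain ⟨i, hi⟩ := Function.invFun_surjective e.injective ⟨x, hx⟩
    exact ⟨i, by simp [hi]⟩

theorem exists_witness {X K : Type u} [TopologicalSpace X] {b : X → K → Set X}
    (hb : IsNhdsSystem b) {D : Set X} {x : X} (h : ∀ U ∈ nhds x, (closure U ∩ D).Nonempty) :
    ∃ f : Finset K → D, x ∈ witnessedBy b (fun F => (f F : X)) := by
  have key : ∀ F : Finset K, (closure (⋂ k ∈ F, b x k) ∩ D).Nonempty := fun F =>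
    h _ ((Filter.biInter_finset_mem F).2 fun k _ => hb.mem x k)
  choose f hf using key
  exact ⟨fun F => ⟨f F, (hf F).2⟩, fun F => (hf F).1⟩

/-- If every point is in the `θ`-closure of `D`, the space has at most `|D| ^ χ` many points. -/
theorem NUrysohn.mk_le_of_thetaDense {X K : Type u} [TopologicalSpace X] [Infinite K] {n : ℕ}
    (h : NUrysohn X n) {b : X → K → Set X} (hb : IsNhdsSystem b) (D : Set X)
    (hD : ∀ x, ∀ U ∈ nhds x, (closure U ∩ D).Nonempty) :
    #X ≤ #D ^ #K * n := by
  choose p hp using h.exists_enumeration hb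
  have hs : Function.Surjective
      (fun q : (Finset K → D) × ULift.{u} (Fin n) => p (fun F => (q.1 F : X)) q.2.down) := by
    intro x
    obtain ⟨f, hf⟩ := exists_witness hb (hD x)
    obtain ⟨i, hi⟩ := hp _ hf
    exact ⟨(f, ⟨i⟩), hi⟩
  simpa using Cardinal.mk_le_of_surjective hs

/-- Well-founded terms built from one constant and `J`-ary operation symbols in `L`. -/
inductive InfTerm (L J : Type u) : Type u
  | leaf : InfTerm L J
  | node : L → (J → InfTerm L J) → InfTerm L J

namespace InfTerm

/-- The label of the subterm reached by a path. -/
def label {L J : Type u} : InfTerm L J → List J → Option L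
  | leaf, _ => none
  | node l _, [] => some l
  | node _ f, j :: s => label (f j) s

theorem label_injective {L J : Type u} : Function.Injective (label (L := L) (J := J)) := by
  intro s
  induction s with
  | leaf =>
    intro t h
    cases t with
    | leaf => rfl
    | node l f => simpa [label] using congrFun h []
  | node l f ih =>
    intro t h
    cases t with
    | leaf => simpa [label] using congrFun h []
    | node l' f' =>
      have h₁ : l = l' := by simpa [label] using congrFun h []
      have h₂ : f = f' := funext fun j => ih j (funext fun s => by
        simpa [label] using congrFun h (j :: s))
      rw [h₁, h₂]

theorem mk_le {L J : Type u} [Infinite J] (hL : #L ≤ 2 ^ #J) : #(InfTerm L J) ≤ 2 ^ #J := by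
  have hJ : ℵ₀ ≤ #J := Cardinal.aleph0_le_mk J
  have h2 : ℵ₀ ≤ (2 : Cardinal.{u}) ^ #J := hJ.trans (Cardinal.cantor _).le
  calc #(InfTerm L J) ≤ #(List J → Option L) := Cardinal.mk_le_of_injective label_injective
    _ = (#L + 1) ^ #J := by simp [Cardinal.mk_list_eq_mk]
    _ ≤ (2 ^ #J) ^ #J := by
        refine Cardinal.power_le_power_right ?_
        exact Cardinal.add_le_of_le h2 hL (Cardinal.one_le_aleph0.trans h2)
    _ = 2 ^ #J := by rw [← Cardinal.power_mul, Cardinal.mul_eq_self hJ]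

/-- Evaluation of terms. -/
def eval {L J Z : Type u} (z₀ : Z) (φ : L → (J → Z) → Z) : InfTerm L J → Z
  | leaf => z₀
  | node l f => φ l fun j => eval z₀ φ (f j)

end InfTerm

theorem exists_closed_under_operations {L J Z : Type u} [Infinite J] (hL : #L ≤ 2 ^ #J) (z₀ : Z)
    (φ : L → (J → Z) → Z) :
    ∃ H : Set Z, #H ≤ 2 ^ #J ∧ z₀ ∈ H ∧ ∀ l (g : J → Z), (∀ j, g j ∈ H) → φ l g ∈ H := by
  refine ⟨range (InfTerm.eval z₀ φ), Cardinal.mk_range_le.trans (InfTerm.mk_le hL),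
    ⟨.leaf, rfl⟩, fun l g hg => ?_⟩
  choose f hf using hg
  exact ⟨.node l f, by simp [InfTerm.eval, hf]⟩

/-- Any choice of open neighbourhoods of the points of `F` has intersecting closures. -/
def ClosureInseparable {X : Type u} [TopologicalSpace X] (F : Set X) : Prop :=
  ∀ U : X → Set X, (∀ x ∈ F, IsOpen (U x) ∧ x ∈ U x) → (⋂ x ∈ F, closure (U x)).Nonempty

theorem NUrysohn.card_lt {X : Type u} [TopologicalSpace X] {n : ℕ} (h : NUrysohn X n)
    {F : Finset X} (hF : ClosureInseparable (F : Set X)) : F.card < n := by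
  classical
  by_contra! hn
  obtain ⟨G, hGF, hG⟩ := Finset.exists_subset_card_eq hn
  let e := G.equivFinOfCardEq hG
  obtain ⟨U, hU, he⟩ := h (fun i => (e.symm i : X)) (Subtype.val_injective.comp e.symm.injective)
  obtain ⟨p, hp⟩ := hF (fun x => if hx : x ∈ G then U (e ⟨x, hx⟩) else univ) (by
    intro x _
    by_cases hx : x ∈ G
    · simpa [hx] using hU (e ⟨x, hx⟩)
    · simp [hx])
  have : p ∈ ⋂ i, closure (U i) := mem_iInter.2 fun i => by
    have := mem_iInter₂.1 hp (e.symm i) (hGF (e.symm i).2)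
    simpa using this
  simp [he] at this

/-- An inseparable set consisting of `y` and points of `H`, maximal with this property. -/
theorem NUrysohn.exists_maximal {X : Type u} [TopologicalSpace X] {n : ℕ} (h : NUrysohn X n)
    (H : Set X) {y : X} (hy : y ∉ H) :
    ∃ A : Finset X, A.card ≤ n - 2 ∧ ClosureInseparable (insert y (A : Set X)) ∧
      ∀ z ∈ H, z ∉ A → ¬ ClosureInseparable (insert z (insert y (A : Set X))) := by
  classical
  by_contra! hno
  have hcard : ∀ A : Finset X, (A : Set X) ⊆ H → ClosureInseparable (insert y (A : Set X)) →
      A.card + 1 < n := by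
    intro A hA hi
    have := h.card_lt (F := insert y A) (by simpa using hi)
    rwa [Finset.card_insert_of_notMem fun hyA => hy (hA hyA)] at this
  have hex : ∀ m : ℕ, ∃ A : Finset X, (A : Set X) ⊆ H ∧ ClosureInseparable (insert y (A : Set X)) ∧
      A.card = m := by
    intro m
    induction m with
    | zero =>
      refine ⟨∅, by simp, fun U hU => ⟨y, ?_⟩, rfl⟩
      simpa using subset_closure (hU y (by simp)).2
    | succ m ih =>
      obtain ⟨A, hA, hi, rfl⟩ := ih
      obtain ⟨z, hz, hzA, hzi⟩ := hno A (by have := hcard A hA hi; omega) hi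
      refine ⟨insert z A, ?_, ?_, Finset.card_insert_of_notMem hzA⟩
      · simpa [insert_subset_iff] using ⟨hz, hA⟩
      · rwa [Finset.coe_insert, insert_comm]
  obtain ⟨A, hA, hi, hc⟩ := hex n
  have := hcard A hA hi
  omega

/-- A set which is `θ`-closed and cannot be covered by finitely many closed basic neighbourhoods
of its points unless the whole space is, fills the whole `n`-H-closed space. -/
theorem NHClosedCovering.eq_univ {Z K J : Type u} [TopologicalSpace Z] [Infinite J] {n : ℕ}
    (hc : NHClosedCovering Z n) (hZ : NUrysohn Z n)
    {b : Z → K → Set Z} (hb : IsNhdsSystem b) {H : Set Z} (hne : H.Nonempty)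
    (hθ : ∀ x, (∀ U ∈ nhds x, (closure U ∩ H).Nonempty) → x ∈ H)
    (hcov : ∀ (g : J → Z) (i : J → K), (∀ j, g j ∈ H) →
      H ⊆ ⋃ j, closure (b (g j) (i j)) → ⋃ j, closure (b (g j) (i j)) = Set.univ) :
    H = Set.univ := by
  classical
  by_contra hH
  obtain ⟨y, hy⟩ := (ne_univ_iff_exists_notMem H).1 hH
  obtain ⟨A, hAc, hAi, hmax⟩ := hZ.exists_maximal H hy
  set F : Set Z := insert y (A : Set Z) with hF
  let Good : Set Z → Prop := fun V => ∃ h ∈ H, ∃ k, V ⊆ b h k ∧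
    ∃ W : Z → Set Z, (∀ x ∈ F, IsOpen (W x) ∧ x ∈ W x) ∧
      closure (b h k) ∩ ⋂ x ∈ F, closure (W x) = ∅
  obtain ⟨𝒱, h𝒱, hfin, hun⟩ := hc (A : Set Z) (by simpa using hAc)
    {V | IsOpen V ∧ (Good V ∨ Disjoint (closure V) H)} (fun V hV => hV.1) (by
      rintro z ⟨-, hzA⟩
      by_cases hz : z ∈ H
      · have hsep := hmax z hz (by simpa using hzA)
        simp only [ClosureInseparable, not_forall] at hsep
        obtain ⟨U, hU, hUe⟩ := hsep
        rw [not_nonempty_iff_eq_empty, biInter_insert] at hUe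
        have hUz := hU z (mem_insert _ _)
        obtain ⟨k, hk⟩ := hb.base z (U z) (hUz.1.mem_nhds hUz.2)
        refine ⟨interior (b z k), ⟨isOpen_interior, .inl ⟨z, hz, k, interior_subset, U,
          fun x hx => hU x (mem_insert_of_mem _ hx), ?_⟩⟩, mem_interior_iff_mem_nhds.2 (hb.mem z k)⟩
        exact subset_empty_iff.1 ((inter_subset_inter_left _ (closure_mono hk)).trans hUe.subset)
      · have := mt (hθ z) hz
        push Not at this
        obtain ⟨U, hU, hUe⟩ := this
        refine ⟨interior U, ⟨isOpen_interior, .inr ?_⟩, mem_interior_iff_mem_nhds.2 hU⟩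
        exact (disjoint_iff_inter_eq_empty.2 hUe).mono_left (closure_mono interior_subset))
  let 𝒲 : Set (Set Z) := {V | V ∈ 𝒱 ∧ Good V}
  have h𝒲fin : 𝒲.Finite := hfin.subset fun V hV => hV.1
  have hcover : ∀ z ∈ H, ∃ V ∈ 𝒲, z ∈ closure V := by
    intro z hz
    obtain ⟨V, hV, hzV⟩ := mem_iUnion₂.1 (hun.symm.subset (mem_univ z))
    rcases (h𝒱 hV).2 with hg | hd
    · exact ⟨V, ⟨hV, hg⟩, hzV⟩
    · exact (disjoint_left.1 hd hzV hz).elim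
  have hgood : ∀ V : 𝒲, Good V := fun V => V.2.2
  choose h hhH k hVk W hW hWe using hgood
  have : Nonempty 𝒲 := by
    obtain ⟨z, hz⟩ := hne
    obtain ⟨V, hV, -⟩ := hcover z hz
    exact ⟨⟨V, hV⟩⟩
  have : Finite 𝒲 := h𝒲fin
  obtain ⟨e⟩ : Nonempty (𝒲 ↪ J) := by
    have := (Cardinal.lift_lt_aleph0.2 (Cardinal.lt_aleph0_of_finite 𝒲)).le.trans
      (Cardinal.aleph0_le_mk J)
    exact Cardinal.le_def _ _ |>.1 (by simpa using this)
  set s : J → 𝒲 := Function.invFun e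
  have hs : Function.Surjective s := Function.invFun_surjective e.injective
  have huniv := hcov (fun j => h (s j)) (fun j => k (s j)) (fun j => hhH _) (by
    intro z hz
    obtain ⟨V, hV, hzV⟩ := hcover z hz
    obtain ⟨j, hj⟩ := hs ⟨V, hV⟩
    refine mem_iUnion.2 ⟨j, closure_mono ?_ hzV⟩
    rw [hj]
    exact hVk ⟨V, hV⟩)
  obtain ⟨p, hp⟩ := hAi (fun x => ⋂ V : 𝒲, W V x) fun x hx =>
    ⟨isOpen_iInter_of_finite fun V => (hW V x hx).1, mem_iInter.2 fun V => (hW V x hx).2⟩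
  obtain ⟨j, hj⟩ := mem_iUnion.1 (huniv.symm.subset (mem_univ p))
  have : p ∈ closure (b (h (s j)) (k (s j))) ∩ ⋂ x ∈ F, closure (W (s j) x) :=
    ⟨hj, mem_iInter₂.2 fun x hx =>
      closure_mono (iInter_subset (fun V => W V x) _) (mem_iInter₂.1 hp x hx)⟩
  simp [hWe] at this

theorem NHClosedCovering.mk_le {Z K : Type u} [TopologicalSpace Z] [Infinite K] {n : ℕ}
    (hc : NHClosedCovering Z n) (hZ : NUrysohn Z n)
    {b : Z → K → Set Z} (hb : IsNhdsSystem b) : #Z ≤ 2 ^ #K := by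
  classical
  rcases isEmpty_or_nonempty Z with hZe | ⟨⟨z₀⟩⟩
  · simp
  choose p hp using hZ.exists_enumeration hb
  have hout : ∀ S : Set Z, ∃ z, S ≠ Set.univ → z ∉ S := by
    intro S
    by_cases hS : S = Set.univ
    · exact ⟨z₀, fun h => (h hS).elim⟩
    · obtain ⟨z, hz⟩ := (ne_univ_iff_exists_notMem S).1 hS
      exact ⟨z, fun _ => hz⟩
  choose out hout using hout
  let φ : ULift.{u} (Fin n) ⊕ (Finset K → K) → (Finset K → Z) → Z := fun l g =>
    l.elim (fun i => p g i.down) (fun i => out (⋃ j, closure (b (g j) (i j))))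
  have hK : ℵ₀ ≤ #K := Cardinal.aleph0_le_mk K
  have h2 : ℵ₀ ≤ (2 : Cardinal.{u}) ^ #K := hK.trans (Cardinal.cantor _).le
  obtain ⟨H, hHc, hz₀, hH⟩ := exists_closed_under_operations (J := Finset K) (by
    simp only [Cardinal.mk_sum, Cardinal.mk_pi, Cardinal.prod_const, Cardinal.mk_finset_of_infinite,
      Cardinal.lift_id, Cardinal.mk_uLift, Cardinal.mk_fin, Cardinal.lift_natCast]
    rw [Cardinal.power_self_eq hK]
    exact Cardinal.add_le_of_le h2 ((Cardinal.natCast_lt_aleph0).le.trans h2) le_rfl) z₀ φ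
  rw [Cardinal.mk_finset_of_infinite] at hHc
  have : H = Set.univ := hc.eq_univ (J := Finset K) hZ hb ⟨z₀, hz₀⟩
    (fun x hx => by
      obtain ⟨f, hf⟩ := exists_witness hb hx
      obtain ⟨i, rfl⟩ := hp _ hf
      exact hH (.inl ⟨i⟩) (fun F => (f F : Z)) fun F => (f F).2)
    (fun g i hg hcov => by
      by_contra hne
      exact hout _ hne (hcov (hH (.inr i) g hg)))
  rwa [this, Cardinal.mk_univ] at hHc

/-- an `n`-Urysohn locally `n`-H-closed space with `wL(X) ≤ λ`
and `χ(X) ≤ κ` satisfies `|X| ≤ λ^κ`. -/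
theorem card_locally_nHClosed_le (n : ℕ) (hn : 2 ≤ n)
    (X : Type u) [TopologicalSpace X] (hX : NUrysohn X n)
    (hloc : LocallyNHClosed X n)
    (κ lam : Cardinal.{u}) (hκ : ℵ₀ ≤ κ) (hlam : ℵ₀ ≤ lam)
    (hwL : WeakLindelofLe X lam) (hchi : CharLe X κ) :
    #X ≤ lam ^ κ := by
  obtain ⟨K, rfl⟩ : ∃ K : Type u, #K = κ := ⟨κ.out, Cardinal.mk_out κ⟩
  have : Infinite K := Cardinal.infinite_iff.2 hκ
  obtain ⟨b, hb⟩ := hchi.exists_isNhdsSystem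
  obtain ⟨𝒱, h𝒱, hcard, hdense⟩ := hwL {U | IsOpen U ∧ NHClosedCovering (closure U) n}
    (fun U hU => hU.1) (eq_univ_of_forall fun x => by
      obtain ⟨U, hU, hx, hc⟩ := hloc x
      exact ⟨U, ⟨hU, hc⟩, hx⟩)
  have hpiece : ∀ V : 𝒱, #(V : Set X) ≤ 2 ^ #K := fun V => by
    obtain ⟨b', hb'⟩ := (hchi.subtype (closure (V : Set X))).exists_isNhdsSystem
    exact (Cardinal.mk_le_mk_of_subset subset_closure).trans
      ((h𝒱 V.2).2.mk_le (hX.subtype _) hb')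
  have hD : #(⋃₀ 𝒱) ≤ lam * 2 ^ #K := by
    rw [sUnion_eq_iUnion]
    exact (Cardinal.mk_iUnion_le _).trans (mul_le_mul' hcard (ciSup_le' hpiece))
  have hX' := hX.mk_le_of_thetaDense hb (⋃₀ 𝒱) fun x U hU => by
    obtain ⟨z, hzU, hz⟩ := mem_closure_iff_nhds.1 (hdense.symm.subset (mem_univ x)) U hU
    exact ⟨z, subset_closure hzU, hz⟩
  have h2 : (2 : Cardinal.{u}) ^ #K ≤ lam ^ #K :=
    Cardinal.power_le_power_right ((Cardinal.natCast_lt_aleph0 (n := 2)).le.trans hlam)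
  have hinf : ℵ₀ ≤ lam ^ #K := (hκ.trans (Cardinal.cantor _).le).trans h2
  calc #X ≤ #(⋃₀ 𝒱) ^ #K * n := hX'
    _ ≤ (lam * 2 ^ #K) ^ #K * lam ^ #K :=
        mul_le_mul' (Cardinal.power_le_power_right hD) (Cardinal.natCast_lt_aleph0.le.trans hinf)
    _ = lam ^ #K * 2 ^ #K * lam ^ #K := by
        rw [Cardinal.mul_power, ← Cardinal.power_mul, Cardinal.mul_eq_self hκ]
    _ ≤ lam ^ #K * lam ^ #K * lam ^ #K := by gcongr
    _ = lam ^ #K := by rw [Cardinal.mul_eq_self hinf, Cardinal.mul_eq_self hinf]
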